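/- Let (X, d_X) and (Y, d_Y) be separable metric spaces and let θ be a Borel probability measure on X × Y with marginals μ, ν having finite first moments. Define dvar(μ) := ∫∫ d_μ(x,x')² dμ(x) dμ(x') and similarly dvar(ν). Then |dcov(θ)| ≤ √( dvar(μ) · dvar(ν) ) ≤ D(μ)·D(ν). -/

import Mathlib

open MeasureTheory

/-- The expected distance `a_μ(x) := ∫ d(x,x') dμ(x')`. -/
noncomputable def expectedDist {X : Type*} [MetricSpace X] [MeasurableSpace X]
    (μ : Measure X) (x : X) : ℝ :=
  ∫ x', dist x x' ∂μ

/-- `D(μ) := ∫∫ d(x,x') dμ(x) dμ(x')`. -/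
noncomputable def measureD {X : Type*} [MetricSpace X] [MeasurableSpace X]
    (μ : Measure X) : ℝ :=
  ∫ x, ∫ x', dist x x' ∂μ ∂μ

/-- The doubly centred distance `d_μ(x₁,x₂) := d(x₁,x₂) − a_μ(x₁) − a_μ(x₂) + D(μ)`. -/
noncomputable def centredDist {X : Type*} [MetricSpace X] [MeasurableSpace X]
    (μ : Measure X) (x₁ x₂ : X) : ℝ :=
  dist x₁ x₂ - expectedDist μ x₁ - expectedDist μ x₂ + measureD μ

/-- The distance covariance
`dcov(θ) := ∫∫ d_μ(x,x')·d_ν(y,y') dθ((x,y)) dθ((x',y'))`, where `μ, ν` are the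
marginals of `θ`. -/
noncomputable def dcov {X Y : Type*} [MetricSpace X] [MetricSpace Y]
    [MeasurableSpace X] [MeasurableSpace Y] (θ : Measure (X × Y)) : ℝ :=
  ∫ p : (X × Y) × (X × Y),
    centredDist (θ.map Prod.fst) p.1.1 p.2.1 * centredDist (θ.map Prod.snd) p.1.2 p.2.2
    ∂(θ.prod θ)

/-- The distance variance of a marginal: `dvar(μ) := ∫∫ d_μ(x,x')² dμ(x) dμ(x')`. -/
noncomputable def dvar {X : Type*} [MetricSpace X] [MeasurableSpace X]
    (μ : Measure X) : ℝ :=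
  ∫ p : X × X, (centredDist μ p.1 p.2) ^ 2 ∂(μ.prod μ)

section DistanceVariance

variable {X : Type*} [MetricSpace X] [MeasurableSpace X] {μ : Measure X}

theorem integral_expectedDist : ∫ x, expectedDist μ x ∂μ = measureD μ := rfl

theorem expectedDist_nonneg (x : X) : 0 ≤ expectedDist μ x :=
  integral_nonneg fun _ => dist_nonneg

theorem measureD_nonneg : 0 ≤ measureD μ :=
  integral_nonneg fun _ => expectedDist_nonneg _

theorem dvar_nonneg : 0 ≤ dvar μ :=
  integral_nonneg fun _ => sq_nonneg _

/-- The defect in the inequality `d(x,y) ≤ a_μ(x) + a_μ(y)`. -/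
noncomputable def distDefect (μ : Measure X) (p : X × X) : ℝ :=
  expectedDist μ p.1 + expectedDist μ p.2 - dist p.1 p.2

theorem centredDist_eq_sub_distDefect (p : X × X) :
    centredDist μ p.1 p.2 = measureD μ - distDefect μ p := by
  simp only [centredDist, distDefect]; ring

theorem distDefect_swap (p : X × X) : distDefect μ p.swap = distDefect μ p := by
  simp [distDefect, dist_comm, add_comm]

variable [SecondCountableTopology X] [BorelSpace X] [IsProbabilityMeasure μ]

theorem integrable_dist_left {o : X} (ho : Integrable (fun x => dist o x) μ) (x : X) :
    Integrable (fun y => dist x y) μ := by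
  refine ((integrable_const (dist x o)).add ho).mono' (by fun_prop) (ae_of_all _ fun y => ?_)
  simpa [abs_of_nonneg] using dist_triangle x o y

theorem integrable_dist_prod {o : X} (ho : Integrable (fun x => dist o x) μ) :
    Integrable (fun p : X × X => dist p.1 p.2) (μ.prod μ) := by
  refine ((ho.comp_fst μ).add (ho.comp_snd μ)).mono'
    (by fun_prop) (ae_of_all _ fun p => ?_)
  simpa [abs_of_nonneg] using dist_triangle_left p.1 p.2 o

theorem integrable_expectedDist {o : X} (ho : Integrable (fun x => dist o x) μ) :
    Integrable (expectedDist μ) μ :=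
  (integrable_dist_prod ho).integral_prod_left

theorem expectedDist_le_dist_add {o : X} (ho : Integrable (fun x => dist o x) μ) (x y : X) :
    expectedDist μ x ≤ dist x y + expectedDist μ y := by
  have hy := integrable_dist_left ho y
  calc expectedDist μ x ≤ ∫ z, (dist x y + dist y z) ∂μ :=
        integral_mono (integrable_dist_left ho x) ((integrable_const _).add hy)
          fun z => dist_triangle x y z
    _ = dist x y + expectedDist μ y := by
        rw [integral_add (integrable_const _) hy]
        simp [expectedDist]

theorem dist_le_expectedDist_add {o : X} (ho : Integrable (fun x => dist o x) μ) (x y : X) :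
    dist x y ≤ expectedDist μ x + expectedDist μ y := by
  have hx := integrable_dist_left ho x
  have hy := integrable_dist_left ho y
  calc dist x y = ∫ _, dist x y ∂μ := by simp
    _ ≤ ∫ z, (dist x z + dist y z) ∂μ :=
        integral_mono (integrable_const _) (hx.add hy) fun z => dist_triangle_right x y z
    _ = expectedDist μ x + expectedDist μ y := integral_add hx hy

theorem distDefect_nonneg {o : X} (ho : Integrable (fun x => dist o x) μ) (p : X × X) :
    0 ≤ distDefect μ p :=
  sub_nonneg.2 (dist_le_expectedDist_add ho _ _)

theorem distDefect_le {o : X} (ho : Integrable (fun x => dist o x) μ) (p : X × X) :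
    distDefect μ p ≤ 2 * expectedDist μ p.2 := by
  have := expectedDist_le_dist_add ho p.1 p.2
  simp only [distDefect]
  linarith

theorem integrable_distDefect {o : X} (ho : Integrable (fun x => dist o x) μ) :
    Integrable (distDefect μ) (μ.prod μ) :=
  (((integrable_expectedDist ho).comp_fst μ).add ((integrable_expectedDist ho).comp_snd μ)).sub
    (integrable_dist_prod ho)

theorem integral_distDefect_right {o : X} (ho : Integrable (fun x => dist o x) μ) (x : X) :
    ∫ y, distDefect μ (x, y) ∂μ = measureD μ := by
  have ha := integrable_expectedDist ho
  have h : Integrable (fun y => expectedDist μ x + expectedDist μ y) μ :=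
    (integrable_const _).add ha
  simp only [distDefect]
  rw [integral_sub h (integrable_dist_left ho x),
    integral_add (integrable_const _) ha, integral_expectedDist]
  simp [expectedDist]

theorem integral_distDefect {o : X} (ho : Integrable (fun x => dist o x) μ) :
    ∫ p, distDefect μ p ∂(μ.prod μ) = measureD μ := by
  rw [integral_prod _ (integrable_distDefect ho)]
  simp [integral_distDefect_right ho]

theorem integrable_expectedDist_mul_distDefect {o : X}
    (ho : Integrable (fun x => dist o x) μ) :
    Integrable (fun p : X × X => expectedDist μ p.1 * distDefect μ p) (μ.prod μ) := by
  have ha := integrable_expectedDist ho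
  refine ((ha.mul_prod ha).const_mul 2).mono'
    ((ha.comp_fst μ).1.mul (integrable_distDefect ho).1) (ae_of_all _ fun p => ?_)
  have h1 := expectedDist_nonneg (μ := μ) p.1
  rw [Real.norm_of_nonneg (mul_nonneg h1 (distDefect_nonneg ho p))]
  nlinarith [mul_le_mul_of_nonneg_left (distDefect_le ho p) h1]

theorem integral_expectedDist_mul_distDefect {o : X}
    (ho : Integrable (fun x => dist o x) μ) :
    ∫ p : X × X, expectedDist μ p.1 * distDefect μ p ∂(μ.prod μ) = measureD μ ^ 2 := by
  rw [integral_prod _ (integrable_expectedDist_mul_distDefect ho)]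
  simp only [integral_const_mul, integral_distDefect_right ho]
  rw [integral_mul_const, integral_expectedDist, sq]

theorem sq_distDefect_le {o : X} (ho : Integrable (fun x => dist o x) μ) (p : X × X) :
    distDefect μ p ^ 2 ≤ expectedDist μ p.1 * distDefect μ p +
      expectedDist μ p.swap.1 * distDefect μ p.swap := by
  have h : distDefect μ p ≤ expectedDist μ p.1 + expectedDist μ p.2 :=
    sub_le_self _ dist_nonneg
  rw [distDefect_swap, Prod.fst_swap]
  nlinarith [mul_le_mul_of_nonneg_right h (distDefect_nonneg ho p)]

theorem integrable_sq_distDefect {o : X} (ho : Integrable (fun x => dist o x) μ) :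
    Integrable (fun p => distDefect μ p ^ 2) (μ.prod μ) := by
  have h := integrable_expectedDist_mul_distDefect ho
  refine (h.add h.swap).mono' ((integrable_distDefect ho).1.pow 2) (ae_of_all _ fun p => ?_)
  rw [Real.norm_of_nonneg (sq_nonneg _)]
  exact sq_distDefect_le ho p

theorem integral_sq_distDefect_le {o : X} (ho : Integrable (fun x => dist o x) μ) :
    ∫ p, distDefect μ p ^ 2 ∂(μ.prod μ) ≤ 2 * measureD μ ^ 2 := by
  have h := integrable_expectedDist_mul_distDefect ho
  have h' : Integrable (fun p : X × X => expectedDist μ p.swap.1 * distDefect μ p.swap)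
      (μ.prod μ) := h.swap
  calc ∫ p, distDefect μ p ^ 2 ∂(μ.prod μ)
      ≤ ∫ p : X × X, (expectedDist μ p.1 * distDefect μ p +
          expectedDist μ p.swap.1 * distDefect μ p.swap) ∂(μ.prod μ) :=
        integral_mono (integrable_sq_distDefect ho) (h.add h') (sq_distDefect_le ho)
    _ = 2 * measureD μ ^ 2 := by
        have hs := integral_prod_swap (μ := μ) (ν := μ)
          (fun p : X × X => expectedDist μ p.1 * distDefect μ p)
        rw [integral_add h h', hs, integral_expectedDist_mul_distDefect ho]
        ring

theorem memLp_centredDist {o : X} (ho : Integrable (fun x => dist o x) μ) :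
    MemLp (fun p : X × X => centredDist μ p.1 p.2) 2 (μ.prod μ) := by
  simp only [centredDist_eq_sub_distDefect]
  exact (memLp_const _).sub
    ((memLp_two_iff_integrable_sq (integrable_distDefect ho).1).2 (integrable_sq_distDefect ho))

theorem dvar_le_sq_measureD {o : X} (ho : Integrable (fun x => dist o x) μ) :
    dvar μ ≤ measureD μ ^ 2 := by
  have h1 := (integrable_distDefect ho).const_mul (2 * measureD μ)
  have h2 := integrable_sq_distDefect ho
  have h3 : Integrable (fun p => measureD μ ^ 2 - 2 * measureD μ * distDefect μ p) (μ.prod μ) :=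
    (integrable_const _).sub h1
  have h : dvar μ = measureD μ ^ 2 - 2 * measureD μ * measureD μ +
      ∫ p, distDefect μ p ^ 2 ∂(μ.prod μ) := by
    simp only [dvar, centredDist_eq_sub_distDefect, sub_sq]
    rw [integral_add h3 h2, integral_sub (integrable_const _) h1,
      integral_const_mul, integral_distDefect ho]
    simp
  linarith [integral_sq_distDefect_le ho]

end DistanceVariance

theorem abs_integral_mul_le_sqrt {Ω : Type*} [MeasurableSpace Ω] {μ : Measure Ω} {f g : Ω → ℝ}
    (hf : MemLp f 2 μ) (hg : MemLp g 2 μ) :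
    |∫ x, f x * g x ∂μ| ≤ Real.sqrt ((∫ x, f x ^ 2 ∂μ) * ∫ x, g x ^ 2 ∂μ) := by
  have h := integral_mul_norm_le_Lp_mul_Lq (μ := μ) (f := f) (g := g)
    Real.HolderConjugate.two_two (by simpa using hf) (by simpa using hg)
  simp only [Real.rpow_two, Real.norm_eq_abs, sq_abs, ← Real.sqrt_eq_rpow] at h
  rw [Real.sqrt_mul (integral_nonneg fun _ => sq_nonneg _)]
  refine abs_integral_le_integral_abs.trans ?_
  simpa only [abs_mul] using h

/-- For a Borel probability measure `θ` on the product of two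
separable metric spaces whose marginals `μ, ν` have finite first moments,
`|dcov(θ)| ≤ √(dvar(μ)·dvar(ν)) ≤ D(μ)·D(ν)`. -/
theorem abs_dcov_le_sqrt_dvar_le_D
    {X Y : Type*} [MetricSpace X] [MetricSpace Y]
    [TopologicalSpace.SeparableSpace X] [TopologicalSpace.SeparableSpace Y]
    [MeasurableSpace X] [BorelSpace X] [MeasurableSpace Y] [BorelSpace Y]
    (θ : Measure (X × Y)) [IsProbabilityMeasure θ]
    (hμ : ∃ o : X, Integrable (fun x => dist o x) (θ.map Prod.fst))
    (hν : ∃ o : Y, Integrable (fun y => dist o y) (θ.map Prod.snd)) :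
    |dcov θ| ≤ Real.sqrt (dvar (θ.map Prod.fst) * dvar (θ.map Prod.snd)) ∧
    Real.sqrt (dvar (θ.map Prod.fst) * dvar (θ.map Prod.snd)) ≤
      measureD (θ.map Prod.fst) * measureD (θ.map Prod.snd) := by
  obtain ⟨o, ho⟩ := hμ
  obtain ⟨o', ho'⟩ := hν
  have : SecondCountableTopology X := UniformSpace.secondCountable_of_separable X
  have : SecondCountableTopology Y := UniformSpace.secondCountable_of_separable Y
  have : IsProbabilityMeasure (θ.map Prod.fst) :=
    Measure.isProbabilityMeasure_map measurable_fst.aemeasurable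
  have : IsProbabilityMeasure (θ.map Prod.snd) :=
    Measure.isProbabilityMeasure_map measurable_snd.aemeasurable
  have hfst : MeasurePreserving (Prod.fst : X × Y → X) θ (θ.map Prod.fst) :=
    measurable_fst.measurePreserving θ
  have hsnd : MeasurePreserving (Prod.snd : X × Y → Y) θ (θ.map Prod.snd) :=
    measurable_snd.measurePreserving θ
  have hF := hfst.prod hfst
  have hG := hsnd.prod hsnd
  have hf := memLp_centredDist ho
  have hg := memLp_centredDist ho'
  constructor
  · have h := abs_integral_mul_le_sqrt (hf.comp_measurePreserving hF)
      (hg.comp_measurePreserving hG)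
    have e1 := integral_map (f := fun p : X × X => centredDist (θ.map Prod.fst) p.1 p.2 ^ 2)
      hF.aemeasurable (by rw [hF.map_eq]; exact hf.1.pow 2)
    have e2 := integral_map (f := fun p : Y × Y => centredDist (θ.map Prod.snd) p.1 p.2 ^ 2)
      hG.aemeasurable (by rw [hG.map_eq]; exact hg.1.pow 2)
    rw [hF.map_eq] at e1
    rw [hG.map_eq] at e2
    rw [dvar, dvar, e1, e2]
    exact h
  · refine Real.sqrt_le_iff.2 ⟨mul_nonneg measureD_nonneg measureD_nonneg, ?_⟩
    rw [mul_pow]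
    exact mul_le_mul (dvar_le_sq_measureD ho) (dvar_le_sq_measureD ho') dvar_nonneg (sq_nonneg _)
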